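/- Let σ_X > 0, σ_R > 0, ρ ∈ (−1, 1), and let (X, R) be a bivariate Gaussian random vector with mean 0, Var(X) = σ_X², Var(R) = σ_R², and correlation ρ. Let S = X·R. Then the kurtosis of S satisfies γ₄(S) = E[(S − E S)⁴]/(Var S)² = 3(3 + 14ρ² + 3ρ⁴)/(1 + ρ²)². -/

import Mathlib

open MeasureTheory Real

/-- The bivariate Gaussian measure on `ℝ × ℝ` with mean `0` and covariance matrix
`[[σX², ρ σX σR], [ρ σX σR, σR²]]`, given by its Lebesgue density.  The first
coordinate is the signal `X`, the second the return `R`. -/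
noncomputable def bivariateGaussian (σX σR ρ : ℝ) : Measure (ℝ × ℝ) :=
  volume.withDensity fun p =>
    ENNReal.ofReal ((2 * π * σX * σR * Real.sqrt (1 - ρ ^ 2))⁻¹ *
      Real.exp (-((p.1 / σX) ^ 2 - 2 * ρ * (p.1 / σX) * (p.2 / σR) + (p.2 / σR) ^ 2) /
        (2 * (1 - ρ ^ 2))))

open ProbabilityTheory

lemma integrable_pow_gaussianReal (n : ℕ) (μ : ℝ) (v : NNReal) :
    Integrable (fun x : ℝ => x ^ n) (gaussianReal μ v) := by
  refine (integrable_norm_iff (by fun_prop)).1 ?_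
  simpa using (memLp_id_gaussianReal (μ := μ) (v := v) n).integrable_norm_pow'

lemma hasDerivAt_gaussianPDFReal (μ : ℝ) {v : NNReal} (hv : v ≠ 0) (x : ℝ) :
    HasDerivAt (gaussianPDFReal μ v) (-((x - μ) / v) * gaussianPDFReal μ v x) x := by
  have hv' : (v : ℝ) ≠ 0 := by exact_mod_cast hv
  have h := ((((((hasDerivAt_id x).sub_const μ).pow 2).neg.div_const (2 * (v : ℝ))).exp).const_mul
    (Real.sqrt (2 * π * v))⁻¹)
  convert! h using 1
  simp only [gaussianPDFReal_def, id, Pi.neg_apply, Pi.pow_apply]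
  field_simp
  simp [mul_comm]

/-- Stein's recursion for the moments of the standard Gaussian. -/
lemma integral_pow_add_two_stdGaussianReal (n : ℕ) :
    ∫ x, x ^ (n + 2) ∂(gaussianReal 0 1) = (n + 1) * ∫ x, x ^ n ∂(gaussianReal 0 1) := by
  have hint (k : ℕ) : Integrable fun x : ℝ => x ^ k * gaussianPDFReal 0 1 x := by
    have h := integrable_pow_gaussianReal k 0 1
    rw [gaussianReal_of_var_ne_zero _ one_ne_zero,
      integrable_withDensity_iff (measurable_gaussianPDF _ _)
        (ae_of_all _ fun _ => gaussianPDF_lt_top)] at h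
    simpa using h
  have h := integral_mul_deriv_eq_deriv_mul_of_integrable
    (u := fun x : ℝ => x ^ (n + 1)) (u' := fun x => (n + 1 : ℝ) * x ^ n)
    (v := gaussianPDFReal 0 1) (v' := fun x => -x * gaussianPDFReal 0 1 x)
    (fun x _ => by simpa using hasDerivAt_pow (n + 1) x)
    (fun x _ => by simpa using hasDerivAt_gaussianPDFReal 0 one_ne_zero x)
    ((hint (n + 2)).neg.congr (ae_of_all _ fun x => by simp; ring))
    (((hint n).const_mul (n + 1 : ℝ)).congr (ae_of_all _ fun x => by simp; ring))
    (hint (n + 1))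
  rw [integral_gaussianReal_eq_integral_smul one_ne_zero,
    integral_gaussianReal_eq_integral_smul one_ne_zero, ← integral_const_mul, ← neg_inj,
    ← integral_neg]
  simp only [smul_eq_mul]
  refine (integral_congr_ae (ae_of_all _ fun x => ?_)).trans
    (h.trans (congrArg _ (integral_congr_ae (ae_of_all _ fun x => ?_))))
  · ring
  · ring

/-- A bivariate Gaussian vector is a linear image of a pair of independent standard Gaussians. -/
lemma integral_bivariateGaussian {σX σR ρ : ℝ} (hσX : 0 < σX) (hσR : 0 < σR)
    (hρ : 0 < 1 - ρ ^ 2) (f : ℝ × ℝ → ℝ) :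
    ∫ p, f p ∂(bivariateGaussian σX σR ρ) =
      ∫ z, f (σX * z.1, σR * (ρ * z.1 + √(1 - ρ ^ 2) * z.2))
        ∂((gaussianReal 0 1).prod (gaussianReal 0 1)) := by
  set s := √(1 - ρ ^ 2) with hs
  have hs0 : 0 < s := Real.sqrt_pos.2 hρ
  have hs2 : s ^ 2 = 1 - ρ ^ 2 := Real.sq_sqrt hρ.le
  let T : ℝ × ℝ →L[ℝ] ℝ × ℝ := LinearMap.toContinuousLinearMap
    (Matrix.toLin (Module.Basis.finTwoProd ℝ) (Module.Basis.finTwoProd ℝ)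
      !![σX, 0; σR * ρ, σR * s])
  have hT (z : ℝ × ℝ) : T z = (σX * z.1, σR * (ρ * z.1 + s * z.2)) := by
    simp [T, Matrix.toLin_finTwoProd_apply]; ring
  have hdet : T.det = σX * (σR * s) := by
    simp [T, ContinuousLinearMap.det, LinearMap.det_toLin, Matrix.det_fin_two_of]
  have hinj : Function.Injective T := by
    intro a b hab
    simp only [hT, Prod.mk.injEq, mul_right_inj' hσX.ne', mul_right_inj' hσR.ne'] at hab
    obtain ⟨h1, h2⟩ := hab
    rw [h1, add_right_inj, mul_right_inj' hs0.ne'] at h2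
    exact Prod.ext h1 h2
  have hsurj : Function.Surjective T :=
    (LinearMap.injective_iff_surjective (f := T.toLinearMap)).1 hinj
  have hcov (g : ℝ × ℝ → ℝ) : ∫ p, g p = ∫ z, |T.det| • g (T z) := by
    simpa [hsurj.range_eq] using integral_image_eq_integral_abs_det_fderiv_smul volume
      MeasurableSet.univ (fun x _ => T.hasFDerivWithinAt (s := Set.univ)) hinj.injOn g
  rw [bivariateGaussian, integral_withDensity_eq_integral_toReal_smul (by fun_prop)
      (ae_of_all _ fun _ => ENNReal.ofReal_lt_top), hcov,
    gaussianReal_of_var_ne_zero _ one_ne_zero,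
    prod_withDensity (measurable_gaussianPDF _ _) (measurable_gaussianPDF _ _),
    integral_withDensity_eq_integral_toReal_smul
      (by fun_prop)
      (ae_of_all _ fun _ => ENNReal.mul_lt_top gaussianPDF_lt_top gaussianPDF_lt_top)]
  refine integral_congr_ae (ae_of_all _ fun z => ?_)
  simp only [hT, hdet, smul_eq_mul, ← mul_assoc]
  congr 1
  have hsqrt : √(2 * π) * √(2 * π) = 2 * π := Real.mul_self_sqrt (by positivity)
  rw [ENNReal.toReal_ofReal (by positivity), ENNReal.toReal_mul, toReal_gaussianPDF,
    toReal_gaussianPDF, gaussianPDFReal_def, abs_of_pos (by positivity)]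
  simp only [NNReal.coe_one, mul_one, sub_zero]
  rw [mul_mul_mul_comm (√(2 * π))⁻¹, ← hs, ← Real.exp_add, ← mul_inv, hsqrt, ← mul_assoc]
  congr 1
  · field_simp
  · congr 1
    rw [mul_div_cancel_left₀ _ hσX.ne', mul_div_cancel_left₀ _ hσR.ne', ← hs2]
    field_simp
    linear_combination z.1 ^ 2 * hs2

lemma integrable_pow_mul_pow_prod_gaussianReal (m n : ℕ) :
    Integrable (fun z : ℝ × ℝ => z.1 ^ m * z.2 ^ n)
      ((gaussianReal 0 1).prod (gaussianReal 0 1)) :=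
  (integrable_pow_gaussianReal m 0 1).mul_prod (integrable_pow_gaussianReal n 0 1)

lemma pow_mul_linear_eq_sum (a b x y : ℝ) (n : ℕ) :
    (x * (a * x + b * y)) ^ n = ∑ k ∈ Finset.range (n + 1),
      a ^ k * b ^ (n - k) * n.choose k * (x ^ (n + k) * y ^ (n - k)) := by
  rw [mul_pow, add_pow, Finset.mul_sum]
  refine Finset.sum_congr rfl fun k _ => ?_
  ring

lemma integrable_pow_mul_linear (a b : ℝ) (n : ℕ) :
    Integrable (fun z : ℝ × ℝ => (z.1 * (a * z.1 + b * z.2)) ^ n)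
      ((gaussianReal 0 1).prod (gaussianReal 0 1)) := by
  simp only [pow_mul_linear_eq_sum]
  exact integrable_finsetSum _ fun k _ =>
    (integrable_pow_mul_pow_prod_gaussianReal _ _).const_mul _

lemma integral_pow_mul_linear (a b : ℝ) (n : ℕ) :
    ∫ z : ℝ × ℝ, (z.1 * (a * z.1 + b * z.2)) ^ n
        ∂((gaussianReal 0 1).prod (gaussianReal 0 1)) =
      ∑ k ∈ Finset.range (n + 1), a ^ k * b ^ (n - k) * n.choose k *
        ((∫ x, x ^ (n + k) ∂(gaussianReal 0 1)) * ∫ y, y ^ (n - k) ∂(gaussianReal 0 1)) := by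
  simp only [pow_mul_linear_eq_sum]
  rw [integral_finsetSum _ fun k _ =>
    (integrable_pow_mul_pow_prod_gaussianReal _ _).const_mul _]
  refine Finset.sum_congr rfl fun k _ => ?_
  rw [integral_const_mul, integral_prod_mul (fun x : ℝ => x ^ (n + k)) fun y : ℝ => y ^ (n - k)]

lemma integral_sub_const_pow {α : Type*} [MeasurableSpace α] {μ : Measure α} {Y : α → ℝ}
    (hY : ∀ j, Integrable (fun x => Y x ^ j) μ) (m : ℝ) (n : ℕ) :
    ∫ x, (Y x - m) ^ n ∂μ =
      ∑ j ∈ Finset.range (n + 1), (∫ x, Y x ^ j ∂μ) * ((-m) ^ (n - j) * n.choose j) := by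
  simp only [sub_eq_add_neg, add_pow, mul_assoc]
  rw [integral_finsetSum _ fun j _ => (hY j).mul_const _]
  exact Finset.sum_congr rfl fun j _ => integral_mul_const _ _

/-- **Kurtosis of a one-period linear strategy.** For `(X, R)` centered bivariate
Gaussian with standard deviations `σX, σR > 0` and correlation `ρ ∈ (−1, 1)`, and
`S = X·R`, the kurtosis satisfies
`γ₄(S) = E[(S − E S)⁴]/(Var S)² = 3(3 + 14ρ² + 3ρ⁴)/(1 + ρ²)²`. -/
theorem kurtosis_linear_strategy (σX σR ρ : ℝ) (hσX : 0 < σX) (hσR : 0 < σR)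
    (h1 : -1 < ρ) (h2 : ρ < 1) :
    (∫ p : ℝ × ℝ,
        (p.1 * p.2 - ∫ q : ℝ × ℝ, q.1 * q.2 ∂(bivariateGaussian σX σR ρ)) ^ 4
          ∂(bivariateGaussian σX σR ρ)) /
      (∫ p : ℝ × ℝ,
        (p.1 * p.2 - ∫ q : ℝ × ℝ, q.1 * q.2 ∂(bivariateGaussian σX σR ρ)) ^ 2
          ∂(bivariateGaussian σX σR ρ)) ^ 2 =
    3 * (3 + 14 * ρ ^ 2 + 3 * ρ ^ 4) / (1 + ρ ^ 2) ^ 2 := by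
  have hρ : 0 < 1 - ρ ^ 2 := by nlinarith
  have hs2 : √(1 - ρ ^ 2) ^ 2 = 1 - ρ ^ 2 := Real.sq_sqrt hρ.le
  have hs4 : √(1 - ρ ^ 2) ^ 4 = (1 - ρ ^ 2) ^ 2 := by
    rw [show (4 : ℕ) = 2 * 2 from rfl, pow_mul, hs2]
  have hprod (z : ℝ × ℝ) : σX * z.1 * (σR * (ρ * z.1 + √(1 - ρ ^ 2) * z.2)) =
      σX * σR * (z.1 * (ρ * z.1 + √(1 - ρ ^ 2) * z.2)) := by ring
  have m1 : ∫ x : ℝ, x ∂(gaussianReal 0 1) = 0 := integral_id_gaussianReal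
  have m2 := integral_pow_add_two_stdGaussianReal 0
  have m3 := integral_pow_add_two_stdGaussianReal 1
  have m4 := integral_pow_add_two_stdGaussianReal 2
  have m5 := integral_pow_add_two_stdGaussianReal 3
  have m6 := integral_pow_add_two_stdGaussianReal 4
  have m7 := integral_pow_add_two_stdGaussianReal 5
  have m8 := integral_pow_add_two_stdGaussianReal 6
  norm_num [m1] at m2 m3
  norm_num [m2, m3] at m4 m5
  norm_num [m4, m5] at m6 m7
  norm_num [m6] at m8
  have e1 := integral_pow_mul_linear ρ (√(1 - ρ ^ 2)) 1
  have e2 := integral_pow_mul_linear ρ (√(1 - ρ ^ 2)) 2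
  have e3 := integral_pow_mul_linear ρ (√(1 - ρ ^ 2)) 3
  have e4 := integral_pow_mul_linear ρ (√(1 - ρ ^ 2)) 4
  norm_num [Finset.sum_range_succ, m1, m2, m3, m4, m5, m6, m7, m8, hs2, hs4, Nat.choose]
    at e1 e2 e3 e4
  have hmean : ∫ p : ℝ × ℝ, p.1 * p.2 ∂(bivariateGaussian σX σR ρ) = σX * σR * ρ := by
    rw [integral_bivariateGaussian hσX hσR hρ]
    simp only [hprod, integral_const_mul, e1]
  have hcentral (n : ℕ) :
      ∫ p : ℝ × ℝ, (p.1 * p.2 - σX * σR * ρ) ^ n ∂(bivariateGaussian σX σR ρ) =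
        (σX * σR) ^ n * ∑ j ∈ Finset.range (n + 1),
          (∫ z : ℝ × ℝ, (z.1 * (ρ * z.1 + √(1 - ρ ^ 2) * z.2)) ^ j
            ∂((gaussianReal 0 1).prod (gaussianReal 0 1))) * ((-ρ) ^ (n - j) * n.choose j) := by
    rw [integral_bivariateGaussian hσX hσR hρ]
    simp only [hprod, ← mul_sub, mul_pow (σX * σR), integral_const_mul]
    rw [integral_sub_const_pow (integrable_pow_mul_linear _ _)]
  have hvar : ∫ p : ℝ × ℝ, (p.1 * p.2 - σX * σR * ρ) ^ 2 ∂(bivariateGaussian σX σR ρ) =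
      (σX * σR) ^ 2 * (1 + ρ ^ 2) := by
    rw [hcentral]
    congr 1
    norm_num [Finset.sum_range_succ, Nat.choose, e1, e2]
    ring
  have hfourth : ∫ p : ℝ × ℝ, (p.1 * p.2 - σX * σR * ρ) ^ 4 ∂(bivariateGaussian σX σR ρ) =
      (σX * σR) ^ 4 * (3 * (3 + 14 * ρ ^ 2 + 3 * ρ ^ 4)) := by
    rw [hcentral]
    congr 1
    norm_num [Finset.sum_range_succ, Nat.choose, e1, e2, e3, e4]
    ring
  rw [hmean, hvar, hfourth, mul_pow _ (1 + ρ ^ 2), ← pow_mul, mul_div_mul_left _ _ (by positivity)]
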